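/- arXiv:2012.10391 — 9 statements merged into one kernel-verified Lean document; each statement's English description precedes it below -/
import Mathlib

section
/- Let μ_e, μ_micro, μ, L_c, h > 0 and κ ∈ ℝ, and set f₁ := √(2(μ_e+μ_micro)/μ) and sech t := 1/cosh t. Define P₁₁ : ℝ → ℝ by P₁₁(x₂) := −(μ_micro·κ/(μ_e+μ_micro))·(L_c/f₁)·sech(f₁h/(2L_c))·sinh(f₁x₂/L_c) − (μ_e·κ/(μ_e+μ_micro))·x₂. Then: (i) for every x₂ ∈ ℝ, μ·L_c²·P₁₁''(x₂) − 2(μ_e+μ_micro)·P₁₁(x₂) − 2μ_e·κ·x₂ = 0; and (ii) P₁₁'(h/2) = −κ and P₁₁'(−h/2) = −κ. -/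
/-- Hyperbolic secant. -/
noncomputable def sech (t : ℝ) : ℝ := 1 / Real.cosh t

/-- The closed-form micro-distortion component `P₁₁` of the relaxed micromorphic
cylindrical bending solution (zero Poisson ratios, one curvature parameter) satisfies
the equilibrium ODE `μL_c²P₁₁'' − 2(μ_e+μ_micro)P₁₁ − 2μ_eκx₂ = 0` and the traction-free
boundary conditions `P₁₁'(±h/2) = −κ`. -/
theorem relaxed_micromorphic_P11_solution (μe μm μ Lc h : ℝ)
    (hμe : 0 < μe) (hμm : 0 < μm) (hμ : 0 < μ) (hLc : 0 < Lc) (hh : 0 < h)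
    (κ : ℝ) (f₁ : ℝ) (hf₁ : f₁ = Real.sqrt (2 * (μe + μm) / μ))
    (P : ℝ → ℝ)
    (hP : P = fun x₂ =>
      -(μm * κ / (μe + μm)) * (Lc / f₁) * sech (f₁ * h / (2 * Lc)) *
          Real.sinh (f₁ * x₂ / Lc)
        - (μe * κ / (μe + μm)) * x₂) :
    (∀ x₂ : ℝ,
        μ * Lc ^ 2 * deriv (deriv P) x₂ - 2 * (μe + μm) * P x₂ - 2 * μe * κ * x₂ = 0) ∧
    deriv P (h / 2) = -κ ∧ deriv P (-h / 2) = -κ := by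
  have hs : 0 < μe + μm := by positivity
  have hf : 0 < f₁ := by rw [hf₁]; positivity
  have hsq : μ * f₁ ^ 2 = 2 * (μe + μm) := by
    rw [hf₁, Real.sq_sqrt (by positivity)]
    field_simp
  have hc : Real.cosh (f₁ * h / (2 * Lc)) ≠ 0 := (Real.cosh_pos _).ne'
  have hlin : ∀ x : ℝ, HasDerivAt (fun x => f₁ * x / Lc) (f₁ / Lc) x := by
    intro x
    simpa using ((hasDerivAt_id x).const_mul f₁).div_const Lc
  have hd : deriv P = fun x => -(μm * κ / (μe + μm)) * sech (f₁ * h / (2 * Lc)) *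
      Real.cosh (f₁ * x / Lc) - μe * κ / (μe + μm) := by
    funext x
    rw [hP]
    have h1 := (((hlin x).sinh).const_mul
      (-(μm * κ / (μe + μm)) * (Lc / f₁) * sech (f₁ * h / (2 * Lc)))).sub
      ((hasDerivAt_id x).const_mul (μe * κ / (μe + μm)))
    refine (h1.congr_deriv ?_).deriv
    field_simp
  refine ⟨?_, ?_, ?_⟩
  · intro x
    have h2 : deriv (deriv P) x = -(μm * κ / (μe + μm)) * sech (f₁ * h / (2 * Lc)) *
        (Real.sinh (f₁ * x / Lc) * (f₁ / Lc)) := by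
      rw [hd]
      exact ((((hlin x).cosh).const_mul
        (-(μm * κ / (μe + μm)) * sech (f₁ * h / (2 * Lc)))).sub_const _).deriv
    rw [h2, hP]
    generalize sech (f₁ * h / (2 * Lc)) = s
    dsimp only
    generalize Real.sinh (f₁ * x / Lc) = t
    field_simp
    linear_combination (-(μm * κ * s * t * Lc)) * hsq
  · rw [hd]
    have e : f₁ * (h / 2) / Lc = f₁ * h / (2 * Lc) := by field_simp
    simp only [e, sech]
    field_simp
    ring
  · rw [hd]
    have e : f₁ * (-h / 2) / Lc = -(f₁ * h / (2 * Lc)) := by field_simp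
    simp only [e, sech, Real.cosh_neg]
    field_simp
    ring
end

section
/- Let μ_e, μ_micro, μ, L_c, h > 0 and κ ∈ ℝ, set f₁ := √(2(μ_e+μ_micro)/μ) and sech t := 1/cosh t. Define g(x₂) := (μ_micro·κ/(μ_e+μ_micro))·((L_c/f₁)·sech(f₁h/(2L_c))·sinh(f₁x₂/L_c) − x₂), P₁₁(x₂) := −(μ_micro·κ/(μ_e+μ_micro))·(L_c/f₁)·sech(f₁h/(2L_c))·sinh(f₁x₂/L_c) − (μ_e·κ/(μ_e+μ_micro))·x₂, and m(x₂) := (μ_micro·κ/(μ_e+μ_micro))·(sech(f₁h/(2L_c))·cosh(f₁x₂/L_c) − 1). Then ∫_{−h/2}^{h/2} (μ_e·g(x₂)² + μ_micro·P₁₁(x₂)² + (μ·L_c²/2)·m(x₂)²) dx₂ = (1/2)·(h³/12)·(2μ_e·μ_micro/(μ_e+μ_micro))·(1 − (12/f₁² − 6μ/μ_e)·(L_c/h)² + (2/f₁)·(12/f₁² − 6μ/μ_e)·(L_c/h)³·tanh(f₁h/(2L_c)))·κ². -/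
/-- Total strain energy per unit plate area of the relaxed micromorphic bending solution
with zero Poisson ratios and one curvature parameter. -/
theorem relaxed_micromorphic_total_energy (μe μm μ Lc h : ℝ)
    (hμe : 0 < μe) (hμm : 0 < μm) (hμ : 0 < μ) (hLc : 0 < Lc) (hh : 0 < h)
    (κ : ℝ) (f₁ : ℝ) (hf₁ : f₁ = Real.sqrt (2 * (μe + μm) / μ))
    (g P m : ℝ → ℝ)
    (hg : g = fun x₂ => (μm * κ / (μe + μm)) *
        ((Lc / f₁) * sech (f₁ * h / (2 * Lc)) * Real.sinh (f₁ * x₂ / Lc) - x₂))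
    (hP : P = fun x₂ =>
      -(μm * κ / (μe + μm)) * (Lc / f₁) * sech (f₁ * h / (2 * Lc)) *
          Real.sinh (f₁ * x₂ / Lc)
        - (μe * κ / (μe + μm)) * x₂)
    (hm : m = fun x₂ => (μm * κ / (μe + μm)) *
        (sech (f₁ * h / (2 * Lc)) * Real.cosh (f₁ * x₂ / Lc) - 1)) :
    (∫ x₂ in (-h/2)..(h/2),
        (μe * g x₂ ^ 2 + μm * P x₂ ^ 2 + (μ * Lc ^ 2 / 2) * m x₂ ^ 2)) =
      (1 / 2) * (h ^ 3 / 12) * (2 * μe * μm / (μe + μm)) *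
        (1 - (12 / f₁ ^ 2 - 6 * μ / μe) * (Lc / h) ^ 2 +
          (2 / f₁) * (12 / f₁ ^ 2 - 6 * μ / μe) * (Lc / h) ^ 3 *
            Real.tanh (f₁ * h / (2 * Lc))) * κ ^ 2 := by
  have hM : 0 < μe + μm := by positivity
  have hf : 0 < f₁ := by rw [hf₁]; positivity
  have hf2 : f₁ ^ 2 = 2 * (μe + μm) / μ := by
    rw [hf₁]; exact Real.sq_sqrt (by positivity)
  have hμ' : μ = 2 * (μe + μm) / f₁ ^ 2 := by
    rw [hf2]; field_simp
  clear hf₁ hf2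
  have hder : ∀ x : ℝ, HasDerivAt (fun x : ℝ => μe * μm * κ ^ 2 / (μe + μm) * (x ^ 3 / 3) +
      μm ^ 2 * κ ^ 2 / (μe + μm) * (sech (f₁ * h / (2 * Lc)) ^ 2 * (Lc / f₁) ^ 3 *
        (Real.sinh (f₁ * x / Lc) * Real.cosh (f₁ * x / Lc))
        - 2 * sech (f₁ * h / (2 * Lc)) * (Lc / f₁) ^ 3 * Real.sinh (f₁ * x / Lc)
        + (Lc / f₁) ^ 2 * x))
      (μe * g x ^ 2 + μm * P x ^ 2 + (μ * Lc ^ 2 / 2) * m x ^ 2) x := by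
    intro x
    have h0 : HasDerivAt (fun x : ℝ => f₁ * x / Lc) (f₁ * 1 / Lc) x :=
      ((hasDerivAt_id x).const_mul f₁).div_const Lc
    have h1 := h0.sinh
    have h2 := h0.cosh
    have h3 := ((hasDerivAt_pow 3 x).div_const 3).const_mul (μe * μm * κ ^ 2 / (μe + μm))
    have h4 := (h1.mul h2).const_mul (sech (f₁ * h / (2 * Lc)) ^ 2 * (Lc / f₁) ^ 3)
    have h5 := h1.const_mul (2 * sech (f₁ * h / (2 * Lc)) * (Lc / f₁) ^ 3)
    have h6 := (hasDerivAt_id x).const_mul ((Lc / f₁) ^ 2)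
    have h7 := h3.add (((h4.sub h5).add h6).const_mul (μm ^ 2 * κ ^ 2 / (μe + μm)))
    refine h7.congr_deriv ?_
    rw [hg, hP, hm, hμ']
    dsimp only
    generalize Real.sinh (f₁ * x / Lc) = S
    generalize Real.cosh (f₁ * x / Lc) = C
    generalize sech (f₁ * h / (2 * Lc)) = q
    push_cast
    field_simp
    ring
  rw [intervalIntegral.integral_eq_sub_of_hasDerivAt (fun x _ => hder x)
    (Continuous.intervalIntegrable (by rw [hg, hP, hm]; fun_prop) _ _)]
  have e1 : f₁ * (h / 2) / Lc = f₁ * h / (2 * Lc) := by field_simp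
  have e2 : f₁ * (-h / 2) / Lc = -(f₁ * h / (2 * Lc)) := by field_simp
  rw [e1, e2, Real.sinh_neg, Real.cosh_neg, Real.tanh_eq_sinh_div_cosh, sech, hμ']
  have hc := Real.cosh_pos (f₁ * h / (2 * Lc))
  generalize Real.sinh (f₁ * h / (2 * Lc)) = S
  generalize Real.cosh (f₁ * h / (2 * Lc)) = C at hc
  field_simp
  ring
end

section
/- Let μ_e, μ_micro, μ, h > 0 and κ ∈ ℝ, and set f₁ := √(2(μ_e+μ_micro)/μ). Define for L_c > 0: M_c(L_c) := (h³/12)·(2μ_e·μ_micro/(μ_e+μ_micro))·(1 − (12/f₁²)·(L_c/h)² + (24/f₁³)·(L_c/h)³·tanh(f₁h/(2L_c)))·κ and M_m(L_c) := (h³/12)·(2μ_micro·μ/(μ_e+μ_micro))·(6·(L_c/h)² − (12/f₁)·(L_c/h)³·tanh(f₁h/(2L_c)))·κ. Then, as L_c → 0⁺, M_c(L_c) tends to (h³/12)·(2μ_e·μ_micro/(μ_e+μ_micro))·κ and M_m(L_c) tends to 0. -/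
/-- Limits of the classical and higher-order bending moments of the relaxed micromorphic
bending solution as the characteristic length `L_c → 0⁺`: `M_c → D_macro·κ` and `M_m → 0`. -/
theorem bending_moments_limit_Lc_zero (μe μm μ h : ℝ)
    (hμe : 0 < μe) (hμm : 0 < μm) (hμ : 0 < μ) (hh : 0 < h)
    (κ : ℝ) (f₁ : ℝ) (hf₁ : f₁ = Real.sqrt (2 * (μe + μm) / μ))
    (Mc Mm : ℝ → ℝ)
    (hMc : Mc = fun Lc => (h ^ 3 / 12) * (2 * μe * μm / (μe + μm)) *
        (1 - (12 / f₁ ^ 2) * (Lc / h) ^ 2 +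
          (24 / f₁ ^ 3) * (Lc / h) ^ 3 * Real.tanh (f₁ * h / (2 * Lc))) * κ)
    (hMm : Mm = fun Lc => (h ^ 3 / 12) * (2 * μm * μ / (μe + μm)) *
        (6 * (Lc / h) ^ 2 - (12 / f₁) * (Lc / h) ^ 3 * Real.tanh (f₁ * h / (2 * Lc))) * κ) :
    Filter.Tendsto Mc (nhdsWithin 0 (Set.Ioi 0))
      (nhds ((h ^ 3 / 12) * (2 * μe * μm / (μe + μm)) * κ)) ∧
    Filter.Tendsto Mm (nhdsWithin 0 (Set.Ioi 0)) (nhds 0) := by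
  have hp : ∀ n : ℕ, n ≠ 0 → Filter.Tendsto (fun Lc : ℝ => (Lc / h) ^ n)
      (nhdsWithin 0 (Set.Ioi 0)) (nhds 0) := by
    intro n hn
    have hc : Continuous (fun Lc : ℝ => (Lc / h) ^ n) := by fun_prop
    have h0 := (hc.tendsto 0).mono_left (nhdsWithin_le_nhds (s := Set.Ioi (0 : ℝ)))
    simpa [hn] using h0
  have h2 := hp 2 (by norm_num)
  have h3 : Filter.Tendsto (fun Lc : ℝ => (Lc / h) ^ 3 * Real.tanh (f₁ * h / (2 * Lc)))
      (nhdsWithin 0 (Set.Ioi 0)) (nhds 0) := by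
    have hn : Filter.Tendsto (fun Lc : ℝ => ‖(Lc / h) ^ 3‖)
        (nhdsWithin 0 (Set.Ioi 0)) (nhds 0) := by
      have h0 := (hp 3 (by norm_num)).norm
      rwa [norm_zero] at h0
    refine squeeze_zero_norm (fun Lc => ?_) hn
    rw [norm_mul]
    exact mul_le_of_le_one_right (norm_nonneg _) (Real.abs_tanh_lt_one _).le
  subst hMc hMm
  constructor
  · have := ((((h2.const_mul (12 / f₁ ^ 2)).const_sub 1).add
      (h3.const_mul (24 / f₁ ^ 3))).const_mul
        ((h ^ 3 / 12) * (2 * μe * μm / (μe + μm)))).mul_const κ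
    simpa only [mul_zero, sub_zero, add_zero, mul_one, ← mul_assoc] using this
  · have := (((h2.const_mul 6).sub (h3.const_mul (12 / f₁))).const_mul
        ((h ^ 3 / 12) * (2 * μm * μ / (μe + μm)))).mul_const κ
    simpa only [mul_zero, sub_zero, zero_mul, ← mul_assoc] using this
end

section
/- Let μ_e, μ_micro, μ, h > 0 and κ ∈ ℝ, and set f₁ := √(2(μ_e+μ_micro)/μ). Define for L_c > 0: M_c(L_c) := (h³/12)·(2μ_e·μ_micro/(μ_e+μ_micro))·(1 − (12/f₁²)·(L_c/h)² + (24/f₁³)·(L_c/h)³·tanh(f₁h/(2L_c)))·κ and M_m(L_c) := (h³/12)·(2μ_micro·μ/(μ_e+μ_micro))·(6·(L_c/h)² − (12/f₁)·(L_c/h)³·tanh(f₁h/(2L_c)))·κ. Then, as L_c → +∞, M_c(L_c) tends to 0 and M_m(L_c) tends to (h³/12)·2μ_micro·κ. -/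
open Filter Topology in
lemma tanh_third_order :
    Tendsto (fun x : ℝ => (x - Real.tanh x) / x ^ 3) (𝓝[≠] 0) (𝓝 (1 / 3)) := by
  have hd : ∀ x : ℝ, HasDerivAt Real.tanh (1 - Real.tanh x ^ 2) x := by
    intro x
    have hc : Real.cosh x ≠ 0 := (Real.cosh_pos x).ne'
    have h := (Real.hasDerivAt_sinh x).div (Real.hasDerivAt_cosh x) hc
    have he : Real.tanh = Real.sinh / Real.cosh := by
      funext y
      simp [Real.tanh_eq_sinh_div_cosh]
    rw [← he] at h
    have e : 1 - Real.tanh x ^ 2 =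
        (Real.cosh x * Real.cosh x - Real.sinh x * Real.sinh x) / Real.cosh x ^ 2 := by
      rw [Real.tanh_eq_sinh_div_cosh]
      field_simp
    rw [e]
    exact h
  have hs : Tendsto (fun x : ℝ => x⁻¹ * Real.tanh x) (𝓝[≠] 0) (𝓝 1) := by
    have h := (hd 0).tendsto_slope_zero
    simpa using h
  have hn : Tendsto (fun x : ℝ => x - Real.tanh x) (𝓝[≠] 0) (𝓝 0) := by
    have h := ((hasDerivAt_id (0 : ℝ)).sub (hd 0)).continuousAt.tendsto
    have h2 := h.mono_left (nhdsWithin_le_nhds (s := {0}ᶜ))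
    have e : (id - Real.tanh : ℝ → ℝ) 0 = 0 := by simp
    rw [e] at h2
    exact h2
  have hg : Tendsto (fun x : ℝ => x ^ 3) (𝓝[≠] 0) (𝓝 0) := by
    have h := ((continuous_pow 3).tendsto (0 : ℝ)).mono_left (nhdsWithin_le_nhds (s := {0}ᶜ))
    simpa using h
  refine HasDerivAt.lhopital_zero_nhdsNE (f' := fun x => 1 - (1 - Real.tanh x ^ 2))
    (g' := fun x => 3 * x ^ 2) ?_ ?_ ?_ hn hg ?_
  · exact Eventually.of_forall fun x => (hasDerivAt_id x).sub (hd x)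
  · exact Eventually.of_forall fun x => by simpa using hasDerivAt_pow 3 x
  · filter_upwards [self_mem_nhdsWithin] with x hx
    have : x ≠ 0 := hx
    positivity
  · have h := (hs.pow 2).mul_const (1 / 3)
    simp only [one_pow, one_mul] at h
    refine h.congr' ?_
    filter_upwards [self_mem_nhdsWithin] with x hx
    have : x ≠ 0 := hx
    field_simp
    ring

/-- Limits of the classical and higher-order bending moments of the relaxed micromorphic
bending solution as the characteristic length `L_c → ∞`: `M_c → 0` and `M_m → D_micro·κ`
with the bounded micro-scale stiffness `D_micro = 2μ_micro·h³/12`. -/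
theorem bending_moments_limit_Lc_infty (μe μm μ h : ℝ)
    (hμe : 0 < μe) (hμm : 0 < μm) (hμ : 0 < μ) (hh : 0 < h)
    (κ : ℝ) (f₁ : ℝ) (hf₁ : f₁ = Real.sqrt (2 * (μe + μm) / μ))
    (Mc Mm : ℝ → ℝ)
    (hMc : Mc = fun Lc => (h ^ 3 / 12) * (2 * μe * μm / (μe + μm)) *
        (1 - (12 / f₁ ^ 2) * (Lc / h) ^ 2 +
          (24 / f₁ ^ 3) * (Lc / h) ^ 3 * Real.tanh (f₁ * h / (2 * Lc))) * κ)
    (hMm : Mm = fun Lc => (h ^ 3 / 12) * (2 * μm * μ / (μe + μm)) *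
        (6 * (Lc / h) ^ 2 - (12 / f₁) * (Lc / h) ^ 3 * Real.tanh (f₁ * h / (2 * Lc))) * κ) :
    Filter.Tendsto Mc Filter.atTop (nhds 0) ∧
    Filter.Tendsto Mm Filter.atTop (nhds ((h ^ 3 / 12) * 2 * μm * κ)) := by
  have hf : 0 < f₁ := by rw [hf₁]; positivity
  have hf2 : f₁ ^ 2 = 2 * (μe + μm) / μ := by
    rw [hf₁]; exact Real.sq_sqrt (by positivity)
  have hx : Filter.Tendsto (fun L : ℝ => f₁ * h / (2 * L)) Filter.atTop (nhdsWithin 0 {0}ᶜ) := by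
    refine tendsto_nhdsWithin_iff.2 ⟨?_, ?_⟩
    · exact Filter.Tendsto.const_div_atTop
        (Filter.Tendsto.const_mul_atTop (by norm_num) Filter.tendsto_id) _
    · filter_upwards [Filter.eventually_gt_atTop 0] with L hL
      have : 0 < f₁ * h / (2 * L) := by positivity
      exact this.ne'
  have key := tanh_third_order.comp hx
  constructor
  · have h1 := (((key.const_mul 3).const_sub 1).const_mul
      ((h ^ 3 / 12) * (2 * μe * μm / (μe + μm)))).mul_const κ
    have e : (h ^ 3 / 12) * (2 * μe * μm / (μe + μm)) * (1 - 3 * (1 / 3)) * κ = 0 := by ring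
    rw [e] at h1
    rw [hMc]
    refine h1.congr' ?_
    filter_upwards [Filter.eventually_gt_atTop 0] with L hL
    simp only [Function.comp]
    generalize Real.tanh (f₁ * h / (2 * L)) = t
    congr 2
    field_simp
    ring
  · have h1 := ((key.const_mul (3 / 2 * f₁ ^ 2)).const_mul
      ((h ^ 3 / 12) * (2 * μm * μ / (μe + μm)))).mul_const κ
    have e : (h ^ 3 / 12) * (2 * μm * μ / (μe + μm)) * (3 / 2 * f₁ ^ 2 * (1 / 3)) * κ
        = (h ^ 3 / 12) * 2 * μm * κ := by
      rw [hf2]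
      field_simp
    rw [e] at h1
    rw [hMm]
    refine h1.congr' ?_
    filter_upwards [Filter.eventually_gt_atTop 0] with L hL
    simp only [Function.comp]
    generalize Real.tanh (f₁ * h / (2 * L)) = t
    congr 2
    field_simp
    ring
end

section
/- Let μ_e, μ_micro, μ, h > 0 and κ ∈ ℝ, and set f₁ := √(2(μ_e+μ_micro)/μ). Define for L_c > 0 the total bending moment M(L_c) := (h³/12)·(2μ_e·μ_micro/(μ_e+μ_micro))·(1 − (12/f₁²)·(L_c/h)² + (24/f₁³)·(L_c/h)³·tanh(f₁h/(2L_c)))·κ + (h³/12)·(2μ_micro·μ/(μ_e+μ_micro))·(6·(L_c/h)² − (12/f₁)·(L_c/h)³·tanh(f₁h/(2L_c)))·κ. Then the function L_c ↦ M(L_c) is bounded on (0, ∞): there exists C ∈ ℝ such that |M(L_c)| ≤ C for all L_c > 0. -/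
theorem aux_sinh_le (y : ℝ) (hy : 0 ≤ y) : Real.sinh y ≤ y * Real.cosh y := by
  have hd : ∀ x : ℝ, HasDerivAt (fun x => x * Real.cosh x - Real.sinh x) (x * Real.sinh x) x := by
    intro x
    have h := ((hasDerivAt_id x).mul (Real.hasDerivAt_cosh x)).sub (Real.hasDerivAt_sinh x)
    refine h.congr_deriv ?_
    simp
  have hm : MonotoneOn (fun x => x * Real.cosh x - Real.sinh x) (Set.Ici (0:ℝ)) := by
    apply monotoneOn_of_deriv_nonneg (convex_Ici 0)
    · exact fun x _ => (hd x).continuousAt.continuousWithinAt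
    · exact fun x _ => (hd x).differentiableAt.differentiableWithinAt
    · intro x hx
      rw [interior_Ici] at hx
      rw [(hd x).deriv]
      have hx' : (0:ℝ) < x := hx
      exact mul_nonneg hx'.le (Real.sinh_nonneg_iff.2 hx'.le)
  have := hm (Set.mem_Ici.2 le_rfl) (Set.mem_Ici.2 hy) hy
  simp at this
  linarith

theorem aux_tanh_bounds (x : ℝ) (hx : 0 < x) :
    0 ≤ (x - Real.tanh x) / x ^ 3 ∧ (x - Real.tanh x) / x ^ 3 ≤ 1 := by
  have hc := Real.cosh_pos x
  have h1 := aux_sinh_le x hx.le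
  have h2 := aux_sinh_le (x / 2) (by positivity)
  have h3 : x ≤ Real.sinh x := Real.self_le_sinh_iff.2 hx.le
  have h0 : 0 ≤ Real.sinh (x / 2) := Real.sinh_nonneg_iff.2 (by positivity)
  have h4 : Real.cosh x = Real.cosh (x / 2) ^ 2 + Real.sinh (x / 2) ^ 2 := by
    rw [← Real.cosh_two_mul]; ring_nf
  have h5 := Real.cosh_sq (x / 2)
  have h6 : Real.sinh (x / 2) ^ 2 ≤ (x / 2 * Real.cosh (x / 2)) ^ 2 := by gcongr
  have h7 : Real.cosh x - 1 ≤ x ^ 2 * Real.cosh x := by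
    have : 0 ≤ x ^ 2 * Real.sinh (x / 2) ^ 2 := by positivity
    have : 0 ≤ x ^ 2 * Real.cosh (x / 2) ^ 2 := by positivity
    rw [h4]
    nlinarith
  rw [Real.tanh_eq_sinh_div_cosh]
  constructor
  · apply div_nonneg _ (by positivity)
    rw [sub_nonneg, div_le_iff₀ hc]
    exact h1
  · rw [div_le_one (by positivity), sub_le_iff_le_add, ← sub_le_iff_le_add', le_div_iff₀ hc]
    nlinarith [mul_le_mul_of_nonneg_left h7 hx.le]

/-- The total bending moment of the relaxed micromorphic cylindrical bending solution
(zero Poisson ratios, one curvature parameter) is bounded as a function of the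
characteristic length `L_c ∈ (0, ∞)`. -/
theorem total_bending_moment_bounded (μe μm μ h : ℝ)
    (hμe : 0 < μe) (hμm : 0 < μm) (hμ : 0 < μ) (hh : 0 < h)
    (κ : ℝ) (f₁ : ℝ) (hf₁ : f₁ = Real.sqrt (2 * (μe + μm) / μ))
    (M : ℝ → ℝ)
    (hM : M = fun Lc =>
      (h ^ 3 / 12) * (2 * μe * μm / (μe + μm)) *
        (1 - (12 / f₁ ^ 2) * (Lc / h) ^ 2 +
          (24 / f₁ ^ 3) * (Lc / h) ^ 3 * Real.tanh (f₁ * h / (2 * Lc))) * κ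
      + (h ^ 3 / 12) * (2 * μm * μ / (μe + μm)) *
        (6 * (Lc / h) ^ 2 - (12 / f₁) * (Lc / h) ^ 3 * Real.tanh (f₁ * h / (2 * Lc))) * κ) :
    ∃ C : ℝ, ∀ Lc : ℝ, 0 < Lc → |M Lc| ≤ C := by
  have hf : 0 < f₁ := by rw [hf₁]; positivity
  refine ⟨|(h ^ 3 / 12) * (2 * μe * μm / (μe + μm)) * κ| * 4
    + |(h ^ 3 / 12) * (2 * μm * μ / (μe + μm)) * κ| * (3 / 2 * f₁ ^ 2), ?_⟩
  intro Lc hL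
  have hx : 0 < f₁ * h / (2 * Lc) := by positivity
  obtain ⟨g0, g1⟩ := aux_tanh_bounds _ hx
  set T := Real.tanh (f₁ * h / (2 * Lc)) with hT
  set g := (f₁ * h / (2 * Lc) - T) / (f₁ * h / (2 * Lc)) ^ 3 with hg
  have e1 : 1 - (12 / f₁ ^ 2) * (Lc / h) ^ 2 + (24 / f₁ ^ 3) * (Lc / h) ^ 3 * T = 1 - 3 * g := by
    rw [hg]; field_simp; ring
  have e2 : 6 * (Lc / h) ^ 2 - (12 / f₁) * (Lc / h) ^ 3 * T = 3 / 2 * f₁ ^ 2 * g := by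
    rw [hg]; field_simp; ring
  have e : M Lc = (h ^ 3 / 12) * (2 * μe * μm / (μe + μm)) * κ * (1 - 3 * g)
      + (h ^ 3 / 12) * (2 * μm * μ / (μe + μm)) * κ * (3 / 2 * f₁ ^ 2 * g) := by
    rw [hM]
    simp only [← hT]
    rw [e1, e2]; ring
  rw [e]
  refine (abs_add_le _ _).trans ?_
  rw [abs_mul, abs_mul _ (3 / 2 * f₁ ^ 2 * g)]
  have b1 : |1 - 3 * g| ≤ 4 := by rw [abs_le]; constructor <;> linarith
  have b2 : |3 / 2 * f₁ ^ 2 * g| ≤ 3 / 2 * f₁ ^ 2 := by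
    rw [abs_of_nonneg (by positivity)]
    exact mul_le_of_le_one_right (by positivity) g1
  gcongr
end

section
/- Let λ, μ ∈ ℝ with λ + 2μ ≠ 0, let μ̄, L_c ≥ 0, a₁, a₂ ∈ ℝ, κ ∈ ℝ and h > 0. Define u : ℝ³ → ℝ³ by u(x₁,x₂,x₃) = (−κx₁x₂, (κ/2)(λ/(λ+2μ)·x₂² + x₁²), 0) and the matrix field A(x₁) := [[0, −κx₁, 0], [κx₁, 0, 0], [0, 0, 0]]. Then: (i) the row-wise matrix curl of A, defined by (Curl A)_{ij} := Σ_{k,l} ε_{jkl} ∂A_{il}/∂x_k with ε the Levi-Civita symbol, has constant squared Frobenius norm ‖Curl A‖² = κ²; (ii) for every x₁, ∫_{−h/2}^{h/2} (μ·‖sym Du(x₁,x₂)‖² + (λ/2)·(tr Du(x₁,x₂))² + (μ̄·L_c²/2)·((a₁+a₂)/2)·‖Curl A‖²) dx₂ = (1/2)·((4μ(λ+μ)/(λ+2μ))·(h³/12) + h·μ̄·L_c²·(a₁+a₂)/2)·κ²; and (iii) if κ ≠ 0, μ̄ > 0 and a₁ + a₂ > 0, this quantity tends to +∞ as L_c →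 +∞. -/
open Matrix

noncomputable section

/-- Partial derivative of a scalar field on `ℝ³` in the `j`-th coordinate direction. -/
noncomputable def pd (j : Fin 3) (f : (Fin 3 → ℝ) → ℝ) (x : Fin 3 → ℝ) : ℝ :=
  fderiv ℝ f x (Pi.single j 1)

/-- Jacobian matrix of a vector field: `(Du)_{ij} = ∂u_i/∂x_j`. -/
noncomputable def jac (u : (Fin 3 → ℝ) → Fin 3 → ℝ) (x : Fin 3 → ℝ) :
    Matrix (Fin 3) (Fin 3) ℝ :=
  Matrix.of fun i j => pd j (fun y => u y i) x

/-- Symmetric part of a matrix. -/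
def symM (M : Matrix (Fin 3) (Fin 3) ℝ) : Matrix (Fin 3) (Fin 3) ℝ :=
  (1 / 2 : ℝ) • (M + Mᵀ)

/-- Levi-Civita symbol on `Fin 3`. -/
def eps (i j k : Fin 3) : ℝ :=
  if (i, j, k) = ((0 : Fin 3), (1 : Fin 3), (2 : Fin 3)) ∨
      (i, j, k) = ((1 : Fin 3), (2 : Fin 3), (0 : Fin 3)) ∨
      (i, j, k) = ((2 : Fin 3), (0 : Fin 3), (1 : Fin 3)) then 1
  else if (i, j, k) = ((2 : Fin 3), (1 : Fin 3), (0 : Fin 3)) ∨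
      (i, j, k) = ((0 : Fin 3), (2 : Fin 3), (1 : Fin 3)) ∨
      (i, j, k) = ((1 : Fin 3), (0 : Fin 3), (2 : Fin 3)) then -1
  else 0

/-- Row-wise matrix curl: `(Curl M)_{ij} = Σ_{k,l} ε_{jkl} ∂M_{il}/∂x_k`. -/
noncomputable def curlM (M : (Fin 3 → ℝ) → Matrix (Fin 3) (Fin 3) ℝ) (x : Fin 3 → ℝ) :
    Matrix (Fin 3) (Fin 3) ℝ :=
  Matrix.of fun i j => ∑ k, ∑ l, eps j k l * pd k (fun y => M y i l) x

/-- Squared Frobenius norm of a `3 × 3` matrix. -/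
def frob2 (M : Matrix (Fin 3) (Fin 3) ℝ) : ℝ := ∑ i, ∑ j, (M i j) ^ 2

theorem pd_of_hasDerivAt (j : Fin 3) (f : (Fin 3 → ℝ) → ℝ) (x : Fin 3 → ℝ) (d : ℝ)
    (hf : DifferentiableAt ℝ f x)
    (hd : HasDerivAt (fun t : ℝ => f (x + t • Pi.single j 1)) d 0) : pd j f x = d := by
  have h1 := hf.hasFDerivAt.hasLineDerivAt (Pi.single j 1)
  exact HasDerivAt.unique h1 hd

theorem pd_const (j : Fin 3) (c : ℝ) (x : Fin 3 → ℝ) : pd j (fun _ => c) x = 0 := by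
  simp [pd]

theorem pd_lin (j : Fin 3) (c : ℝ) (x : Fin 3 → ℝ) :
    pd j (fun y => c * y 0) x = c * (Pi.single j 1 : Fin 3 → ℝ) 0 := by
  apply pd_of_hasDerivAt
  · fun_prop
  · have := (((hasDerivAt_id (0:ℝ)).mul_const ((Pi.single j 1 : Fin 3 → ℝ) 0)).const_add
      (x 0)).const_mul c
    simpa using this

theorem pd_u0 (j : Fin 3) (c : ℝ) (x : Fin 3 → ℝ) :
    pd j (fun y => c * y 0 * y 1) x =
      c * (Pi.single j 1 : Fin 3 → ℝ) 0 * x 1 + c * x 0 * (Pi.single j 1 : Fin 3 → ℝ) 1 := by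
  apply pd_of_hasDerivAt
  · fun_prop
  · have h0 := (((hasDerivAt_id (0:ℝ)).mul_const ((Pi.single j 1 : Fin 3 → ℝ) 0)).const_add
      (x 0)).const_mul c
    have h1 := ((hasDerivAt_id (0:ℝ)).mul_const ((Pi.single j 1 : Fin 3 → ℝ) 1)).const_add (x 1)
    have h2 := h0.fun_mul h1
    simpa using h2

theorem pd_u1 (j : Fin 3) (c d : ℝ) (x : Fin 3 → ℝ) :
    pd j (fun y => c * (d * (y 1) ^ 2 + (y 0) ^ 2)) x =
      c * (d * (2 * x 1 * (Pi.single j 1 : Fin 3 → ℝ) 1)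
        + 2 * x 0 * (Pi.single j 1 : Fin 3 → ℝ) 0) := by
  apply pd_of_hasDerivAt
  · fun_prop
  · have h0 := ((hasDerivAt_id (0:ℝ)).mul_const ((Pi.single j 1 : Fin 3 → ℝ) 0)).const_add (x 0)
    have h1 := ((hasDerivAt_id (0:ℝ)).mul_const ((Pi.single j 1 : Fin 3 → ℝ) 1)).const_add (x 1)
    simpa using (((h1.pow 2).const_mul d).add (h0.pow 2)).const_mul c

theorem curl_aux (κ : ℝ) (x : Fin 3 → ℝ) :
    frob2 (curlM (fun x => !![0, -κ * x 0, 0; κ * x 0, 0, 0; 0, 0, 0]) x) = κ ^ 2 := by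
  simp [frob2, curlM, Fin.sum_univ_three, eps, pd_const, pd_lin, -neg_mul]

theorem jac_aux (κ c : ℝ) (x : Fin 3 → ℝ) :
    jac (fun x => ![-κ * x 0 * x 1, (κ / 2) * (c * (x 1) ^ 2 + (x 0) ^ 2), 0]) x
      = !![-κ * x 1, -κ * x 0, 0; κ * x 0, κ * c * x 1, 0; 0, 0, 0] := by
  ext i j
  fin_cases i <;> fin_cases j <;>
    simp [jac, pd_const, pd_u0, pd_u1, -neg_mul] <;> ring

theorem energy_aux (lam mu : ℝ) (hlm : lam + 2 * mu ≠ 0) (K κ h x₁ : ℝ) :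
    (∫ x₂ in (-h/2)..(h/2),
      (mu * frob2 (symM (jac (fun x => ![-κ * x 0 * x 1,
        (κ / 2) * (lam / (lam + 2 * mu) * (x 1) ^ 2 + (x 0) ^ 2), 0]) ![x₁, x₂, 0])) +
        (lam / 2) * (Matrix.trace (jac (fun x => ![-κ * x 0 * x 1,
        (κ / 2) * (lam / (lam + 2 * mu) * (x 1) ^ 2 + (x 0) ^ 2), 0]) ![x₁, x₂, 0])) ^ 2 +
        K * frob2 (curlM (fun x => !![0, -κ * x 0, 0; κ * x 0, 0, 0; 0, 0, 0]) ![x₁, x₂, 0]))) =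
    (1 / 2) * ((4 * mu * (lam + mu) / (lam + 2 * mu)) * (h ^ 3 / 12)) * κ ^ 2 + h * K * κ ^ 2 := by
  have key : ∀ x₂ : ℝ, (mu * frob2 (symM (jac (fun x => ![-κ * x 0 * x 1,
        (κ / 2) * (lam / (lam + 2 * mu) * (x 1) ^ 2 + (x 0) ^ 2), 0]) ![x₁, x₂, 0])) +
        (lam / 2) * (Matrix.trace (jac (fun x => ![-κ * x 0 * x 1,
        (κ / 2) * (lam / (lam + 2 * mu) * (x 1) ^ 2 + (x 0) ^ 2), 0]) ![x₁, x₂, 0])) ^ 2 +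
        K * frob2 (curlM (fun x => !![0, -κ * x 0, 0; κ * x 0, 0, 0; 0, 0, 0]) ![x₁, x₂, 0]))
      = (2 * mu * (lam + mu) / (lam + 2 * mu) * κ ^ 2) * x₂ ^ 2 + K * κ ^ 2 := by
    intro x₂
    rw [curl_aux, jac_aux]
    obtain ⟨D, rfl⟩ : ∃ D, lam = D - 2 * mu := ⟨lam + 2 * mu, by ring⟩
    rw [sub_add_cancel] at hlm ⊢
    simp [frob2, symM, Fin.sum_univ_three, Matrix.trace]
    field_simp
    ring
  simp_rw [key]
  rw [intervalIntegral.integral_add (by apply Continuous.intervalIntegrable; fun_prop)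
    (by apply Continuous.intervalIntegrable; fun_prop), intervalIntegral.integral_const_mul]
  simp
  field_simp
  ring

/-- Cylindrical bending of an isotropic Cosserat plate in dislocation format:
`‖Curl A‖² = κ²`, the total energy per unit area equals
`(1/2)(D_macro + hμ̄L_c²(a₁+a₂)/2)κ²`, and this blows up as `L_c → ∞`. -/
theorem cosserat_cylindrical_bending (lam mu : ℝ) (hlm : lam + 2 * mu ≠ 0)
    (mubar Lc : ℝ) (hmubar : 0 ≤ mubar) (hLc : 0 ≤ Lc)
    (a₁ a₂ κ h : ℝ) (hh : 0 < h)
    (u : (Fin 3 → ℝ) → Fin 3 → ℝ)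
    (hu : u = fun x => ![-κ * x 0 * x 1,
        (κ / 2) * (lam / (lam + 2 * mu) * (x 1) ^ 2 + (x 0) ^ 2), 0])
    (A : (Fin 3 → ℝ) → Matrix (Fin 3) (Fin 3) ℝ)
    (hA : A = fun x => !![0, -κ * x 0, 0; κ * x 0, 0, 0; 0, 0, 0]) :
    (∀ x : Fin 3 → ℝ, frob2 (curlM A x) = κ ^ 2) ∧
    (∀ x₁ : ℝ,
      (∫ x₂ in (-h/2)..(h/2),
          (mu * frob2 (symM (jac u ![x₁, x₂, 0])) +
            (lam / 2) * (Matrix.trace (jac u ![x₁, x₂, 0])) ^ 2 +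
            (mubar * Lc ^ 2 / 2) * ((a₁ + a₂) / 2) * frob2 (curlM A ![x₁, x₂, 0]))) =
        (1 / 2) * ((4 * mu * (lam + mu) / (lam + 2 * mu)) * (h ^ 3 / 12) +
          h * mubar * Lc ^ 2 * (a₁ + a₂) / 2) * κ ^ 2) ∧
    (κ ≠ 0 → 0 < mubar → 0 < a₁ + a₂ → ∀ x₁ : ℝ,
      Filter.Tendsto (fun L : ℝ =>
          ∫ x₂ in (-h/2)..(h/2),
            (mu * frob2 (symM (jac u ![x₁, x₂, 0])) +
              (lam / 2) * (Matrix.trace (jac u ![x₁, x₂, 0])) ^ 2 +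
              (mubar * L ^ 2 / 2) * ((a₁ + a₂) / 2) * frob2 (curlM A ![x₁, x₂, 0])))
        Filter.atTop Filter.atTop) := by
  subst hu hA
  refine ⟨curl_aux κ, fun x₁ => ?_, fun hκ hm ha x₁ => ?_⟩
  · rw [energy_aux lam mu hlm]
    ring
  · simp_rw [energy_aux lam mu hlm]
    apply Filter.tendsto_atTop_add_const_left
    have hc : 0 < h * (mubar / 2 * ((a₁ + a₂) / 2)) * κ ^ 2 := by positivity
    have := (Filter.tendsto_pow_atTop (α := ℝ) two_ne_zero).const_mul_atTop hc
    refine this.congr fun L => ?_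
    ring
end
end

section
/- Let χ : Fin 3 × Fin 3 × Fin 3 → ℝ satisfy χ_{ijk} = χ_{jik} for all i, j, k, and let a₁, a₂, a₃ ∈ ℝ. For each i ∈ Fin 3 define the 3×3 matrix Q_i by (Q_i)_{jk} := χ_{kij}, and write dev M := M − (tr M/3)·I, sym M := (M+Mᵀ)/2, skew M := (M−Mᵀ)/2, ‖·‖ the Frobenius norm. Then Σ_i (a₁·‖dev sym Q_i‖² + a₂·‖skew Q_i‖² + (2/9)·a₃·(tr Q_i)²) = ((a₁+a₂)/2)·Σ χ_{ijk}χ_{ijk} + ((a₁−a₂)/2)·Σ χ_{ijk}χ_{kji} + ((2a₃−3a₁)/9)·Σ_i (Σ_j χ_{ijj})·(Σ_k χ_{ikk}), with repeated indices summed over Fin 3. -/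
open Matrix

noncomputable section

/-- Skew-symmetric part of a matrix. -/
def skewM (M : Matrix (Fin 3) (Fin 3) ℝ) : Matrix (Fin 3) (Fin 3) ℝ :=
  (1 / 2 : ℝ) • (M - Mᵀ)

/-- Deviatoric part of a matrix. -/
def devM (M : Matrix (Fin 3) (Fin 3) ℝ) : Matrix (Fin 3) (Fin 3) ℝ :=
  M - (Matrix.trace M / 3) • (1 : Matrix (Fin 3) (Fin 3) ℝ)

/-- The simplified isotropic second-gradient curvature energy
`Σ_i [a₁‖dev sym Q_i‖² + a₂‖skew Q_i‖² + (2/9)a₃ tr²Q_i]` with `(Q_i)_{jk} = χ_{kij}`,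
for `χ` symmetric in its first two indices, expressed through the classical Mindlin
second-gradient invariants. -/
theorem second_gradient_curvature_mindlin_invariants
    (χ : Fin 3 → Fin 3 → Fin 3 → ℝ) (hsym : ∀ i j k, χ i j k = χ j i k)
    (a₁ a₂ a₃ : ℝ) (Q : Fin 3 → Matrix (Fin 3) (Fin 3) ℝ)
    (hQ : Q = fun i => Matrix.of fun j k => χ k i j) :
    (∑ i, (a₁ * frob2 (devM (symM (Q i))) + a₂ * frob2 (skewM (Q i)) +
        (2 / 9) * a₃ * (Matrix.trace (Q i)) ^ 2)) =
      ((a₁ + a₂) / 2) * (∑ i, ∑ j, ∑ k, χ i j k * χ i j k)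
      + ((a₁ - a₂) / 2) * (∑ i, ∑ j, ∑ k, χ i j k * χ k j i)
      + ((2 * a₃ - 3 * a₁) / 9) * (∑ i, (∑ j, χ i j j) * (∑ k, χ i k k)) := by
  subst hQ
  simp only [frob2, devM, symM, skewM, Matrix.trace, Fin.sum_univ_three, Matrix.diag_apply,
    Matrix.sub_apply, Matrix.add_apply, Matrix.smul_apply, Matrix.transpose_apply,
    Matrix.of_apply, smul_eq_mul, Matrix.one_apply]
  simp only [hsym 1 0, hsym 2 0, hsym 2 1]
  simp
  ring
end
end

section
/- Let a₁, a₂, μ_e, μ_micro, μ, L_c > 0, κ ∈ ℝ and c₁, c₂, c₃, c₄ ∈ ℝ. Set f₁ := √(2(μ_e+μ_micro)/(a₁μ)) and f₂ := √(2(μ_e+μ_micro)/(a₂μ)). Define P₁₁(x₂) := ((c₁−c₃)/2)·cosh(f₁x₂/L_c) + ((c₁+c₃)/2)·cosh(f₂x₂/L_c) + ((c₂−c₄)/2)·(L_c/f₁)·sinh(f₁x₂/L_c) + ((c₂+c₄)/2)·(L_c/f₂)·sinh(f₂x₂/L_c) − (μ_e/(μ_e+μ_micro))·κ·x₂ and P₃₃(x₂)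 := ((c₃−c₁)/2)·cosh(f₁x₂/L_c) + ((c₁+c₃)/2)·cosh(f₂x₂/L_c) + ((c₄−c₂)/2)·(L_c/f₁)·sinh(f₁x₂/L_c) + ((c₂+c₄)/2)·(L_c/f₂)·sinh(f₂x₂/L_c). Then for every x₂ ∈ ℝ: μ·L_c²·((a₁+a₂)·P₁₁''(x₂) − (a₁−a₂)·P₃₃''(x₂)) − 4μ_e·(P₁₁(x₂)+κx₂) − 4μ_micro·P₁₁(x₂) = 0 and μ·L_c²·((a₁+a₂)·P₃₃''(x₂) − (a₁−a₂)·P₁₁''(x₂)) − 4(μ_e+μ_micro)·P₃₃(x₂) = 0. -/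
theorem second_deriv_aux (A B C D K f g L x : ℝ) :
    deriv (deriv (fun x : ℝ => A * Real.cosh (f * x / L) + B * Real.cosh (g * x / L) +
      C * Real.sinh (f * x / L) + D * Real.sinh (g * x / L) - K * x)) x =
    (f / L) ^ 2 * (A * Real.cosh (f * x / L) + C * Real.sinh (f * x / L)) +
    (g / L) ^ 2 * (B * Real.cosh (g * x / L) + D * Real.sinh (g * x / L)) := by
  have hl : ∀ (q y : ℝ), HasDerivAt (fun x : ℝ => q * x / L) (q / L) y := by
    intro q y
    simpa using ((hasDerivAt_id y).const_mul q).div_const L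
  have h1 : deriv (fun x : ℝ => A * Real.cosh (f * x / L) + B * Real.cosh (g * x / L) +
      C * Real.sinh (f * x / L) + D * Real.sinh (g * x / L) - K * x) =
      fun y => A * (Real.sinh (f * y / L) * (f / L)) + B * (Real.sinh (g * y / L) * (g / L)) +
        C * (Real.cosh (f * y / L) * (f / L)) + D * (Real.cosh (g * y / L) * (g / L)) - K * 1 := by
    funext y
    exact ((((((hl f y).cosh.const_mul A).add ((hl g y).cosh.const_mul B)).add
      ((hl f y).sinh.const_mul C)).add ((hl g y).sinh.const_mul D)).sub
      ((hasDerivAt_id y).const_mul K)).deriv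
  rw [h1]
  have h2 := (((((((hl f x).sinh.mul_const (f / L)).const_mul A).add
    (((hl g x).sinh.mul_const (g / L)).const_mul B)).add
      (((hl f x).cosh.mul_const (f / L)).const_mul C)).add
      (((hl g x).cosh.mul_const (g / L)).const_mul D)).sub_const (K * 1)).deriv
  refine Eq.trans h2 ?_
  ring

/-- The closed-form hyperbolic profiles `P₁₁, P₃₃` solve the coupled ODE system of the
cylindrical bending equilibrium equations of the relaxed micromorphic model with full
isotropic curvature and zero Poisson ratios. -/
theorem relaxed_micromorphic_full_curvature_ODEs (a₁ a₂ μe μm μ Lc : ℝ)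
    (ha₁ : 0 < a₁) (ha₂ : 0 < a₂) (hμe : 0 < μe) (hμm : 0 < μm) (hμ : 0 < μ)
    (hLc : 0 < Lc) (κ c₁ c₂ c₃ c₄ : ℝ) (f₁ f₂ : ℝ)
    (hf₁ : f₁ = Real.sqrt (2 * (μe + μm) / (a₁ * μ)))
    (hf₂ : f₂ = Real.sqrt (2 * (μe + μm) / (a₂ * μ)))
    (P₁₁ P₃₃ : ℝ → ℝ)
    (hP11 : P₁₁ = fun x₂ =>
      ((c₁ - c₃) / 2) * Real.cosh (f₁ * x₂ / Lc) +
      ((c₁ + c₃) / 2) * Real.cosh (f₂ * x₂ / Lc) +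
      ((c₂ - c₄) / 2) * (Lc / f₁) * Real.sinh (f₁ * x₂ / Lc) +
      ((c₂ + c₄) / 2) * (Lc / f₂) * Real.sinh (f₂ * x₂ / Lc) -
      (μe / (μe + μm)) * κ * x₂)
    (hP33 : P₃₃ = fun x₂ =>
      ((c₃ - c₁) / 2) * Real.cosh (f₁ * x₂ / Lc) +
      ((c₁ + c₃) / 2) * Real.cosh (f₂ * x₂ / Lc) +
      ((c₄ - c₂) / 2) * (Lc / f₁) * Real.sinh (f₁ * x₂ / Lc) +
      ((c₂ + c₄) / 2) * (Lc / f₂) * Real.sinh (f₂ * x₂ / Lc)) :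
    ∀ x₂ : ℝ,
      μ * Lc ^ 2 * ((a₁ + a₂) * deriv (deriv P₁₁) x₂ -
          (a₁ - a₂) * deriv (deriv P₃₃) x₂) -
        4 * μe * (P₁₁ x₂ + κ * x₂) - 4 * μm * P₁₁ x₂ = 0 ∧
      μ * Lc ^ 2 * ((a₁ + a₂) * deriv (deriv P₃₃) x₂ -
          (a₁ - a₂) * deriv (deriv P₁₁) x₂) -
        4 * (μe + μm) * P₃₃ x₂ = 0 := by
  intro x
  have hs : 0 < μe + μm := by positivity
  have e1 : a₁ * μ * f₁ ^ 2 = 2 * (μe + μm) := by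
    rw [hf₁, Real.sq_sqrt (by positivity)]
    field_simp
  have e2 : a₂ * μ * f₂ ^ 2 = 2 * (μe + μm) := by
    rw [hf₂, Real.sq_sqrt (by positivity)]
    field_simp
  have d1 := second_deriv_aux ((c₁ - c₃) / 2) ((c₁ + c₃) / 2) ((c₂ - c₄) / 2 * (Lc / f₁))
    ((c₂ + c₄) / 2 * (Lc / f₂)) (μe / (μe + μm) * κ) f₁ f₂ Lc x
  have d3 := second_deriv_aux ((c₃ - c₁) / 2) ((c₁ + c₃) / 2) ((c₄ - c₂) / 2 * (Lc / f₁))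
    ((c₂ + c₄) / 2 * (Lc / f₂)) 0 f₁ f₂ Lc x
  simp only [zero_mul, sub_zero] at d3
  rw [← hP11] at d1
  rw [← hP33] at d3
  rw [d1, d3, hP11, hP33]
  clear d1 d3 hP11 hP33 hf₁ hf₂
  have k1 : μe / (μe + μm) * (μe + μm) = μe := by field_simp
  have l1 : Lc ^ 2 * (f₁ / Lc) ^ 2 = f₁ ^ 2 := by field_simp
  have l2 : Lc ^ 2 * (f₂ / Lc) ^ 2 = f₂ ^ 2 := by field_simp
  have g1 : a₁ * μ * (Lc ^ 2 * (f₁ / Lc) ^ 2) = 2 * (μe + μm) := by rw [l1, e1]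
  have g2 : a₂ * μ * (Lc ^ 2 * (f₂ / Lc) ^ 2) = 2 * (μe + μm) := by rw [l2, e2]
  clear l1 l2 e1 e2
  beta_reduce
  generalize Real.cosh (f₁ * x / Lc) = C1
  generalize Real.cosh (f₂ * x / Lc) = C2
  generalize Real.sinh (f₁ * x / Lc) = S1
  generalize Real.sinh (f₂ * x / Lc) = S2
  generalize f₁ / Lc = p at *
  generalize f₂ / Lc = q at *
  generalize Lc / f₁ = r at *
  generalize Lc / f₂ = s at *
  generalize μe / (μe + μm) = k at *
  constructor
  · linear_combination (2 * ((c₁ - c₃) / 2 * C1 + (c₂ - c₄) / 2 * r * S1)) * g1 +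
      (2 * ((c₁ + c₃) / 2 * C2 + (c₂ + c₄) / 2 * s * S2)) * g2 + 4 * κ * x * k1
  · linear_combination (-2 * ((c₁ - c₃) / 2 * C1 + (c₂ - c₄) / 2 * r * S1)) * g1 +
      (2 * ((c₁ + c₃) / 2 * C2 + (c₂ + c₄) / 2 * s * S2)) * g2
end

section
/- Let λ, μ_m ∈ ℝ with λ + 2μ_m > 0, let μ, L_c > 0, κ ∈ ℝ and c₁, c₂, c₃, c₄ ∈ ℝ. Define v(x₂) := (2μL_c²/(λ+2μ_m))·(c₁·e^{−x₂·√((λ+2μ_m)/μ)/L_c} + c₂·e^{x₂·√((λ+2μ_m)/μ)/L_c}) + (λ·κ/(2(λ+2μ_m)))·x₂² + c₄·x₂ + c₃. Then for every x₂ ∈ ℝ: −μ·L_c²·v''''(x₂) + (λ+2μ_m)·v''(x₂) − λ·κ = 0. -/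
theorem deriv_form (k A B C D E : ℝ) :
    deriv (fun x : ℝ => A * Real.exp (-(k * x)) + B * Real.exp (k * x) + C * x ^ 2 + D * x + E) =
      fun x : ℝ => (-(k * A)) * Real.exp (-(k * x)) + (k * B) * Real.exp (k * x) + 0 * x ^ 2 +
        (2 * C) * x + D := by
  funext x
  have hk : HasDerivAt (fun x : ℝ => k * x) k x := by
    simpa using (hasDerivAt_id x).const_mul k
  have hD : HasDerivAt (fun x : ℝ => D * x) D x := by
    simpa using (hasDerivAt_id x).const_mul D
  have h := (((((hk.neg.exp).const_mul A).add ((hk.exp).const_mul B)).add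
    ((hasDerivAt_pow 2 x).const_mul C)).add hD).add_const E
  refine (HasDerivAt.deriv (f' := _) h).trans ?_
  simp only [Pi.neg_apply]
  norm_num
  ring

/-- The displayed function `v` (boundary-layer exponentials plus quadratic particular
solution plus affine part) solves the fourth-order ODE of cylindrical bending in
isotropic second gradient elasticity with one curvature parameter:
`−μL_c²v'''' + (λ+2μ_macro)v'' − λκ = 0`. -/
theorem second_gradient_bending_ODE (lam μm : ℝ) (h1 : 0 < lam + 2 * μm)
    (μ Lc : ℝ) (hμ : 0 < μ) (hLc : 0 < Lc) (κ c₁ c₂ c₃ c₄ : ℝ) (v : ℝ → ℝ)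
    (hv : v = fun x₂ =>
      (2 * μ * Lc ^ 2 / (lam + 2 * μm)) *
          (c₁ * Real.exp (-(x₂ * Real.sqrt ((lam + 2 * μm) / μ)) / Lc) +
            c₂ * Real.exp ((x₂ * Real.sqrt ((lam + 2 * μm) / μ)) / Lc)) +
        (lam * κ / (2 * (lam + 2 * μm))) * x₂ ^ 2 + c₄ * x₂ + c₃) :
    ∀ x₂ : ℝ,
      -(μ * Lc ^ 2 * iteratedDeriv 4 v x₂) + (lam + 2 * μm) * iteratedDeriv 2 v x₂ -
        lam * κ = 0 := by
  intro x
  set M := lam + 2 * μm with hM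
  have hM0 : M ≠ 0 := h1.ne'
  have hs : Real.sqrt (M / μ) ^ 2 = M / μ := Real.sq_sqrt (div_pos h1 hμ).le
  set k := Real.sqrt (M / μ) / Lc with hk
  have hk2 : μ * Lc ^ 2 * k ^ 2 = M := by
    rw [hk, div_pow, hs]
    field_simp
  have hv' : v = fun x : ℝ => (2 * μ * Lc ^ 2 / M * c₁) * Real.exp (-(k * x)) +
      (2 * μ * Lc ^ 2 / M * c₂) * Real.exp (k * x) + (lam * κ / (2 * M)) * x ^ 2 + c₄ * x + c₃ := by
    rw [hv]
    funext y
    have e1 : -(y * Real.sqrt (M / μ)) / Lc = -(k * y) := by rw [hk]; ring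
    have e2 : (y * Real.sqrt (M / μ)) / Lc = k * y := by rw [hk]; ring
    rw [e1, e2]
    ring
  rw [hv']
  simp only [iteratedDeriv_succ', iteratedDeriv_zero, deriv_form]
  generalize 2 * μ * Lc ^ 2 / M * c₁ = A
  generalize 2 * μ * Lc ^ 2 / M * c₂ = B
  have hC : M * (2 * (lam * κ / (2 * M))) = lam * κ := by field_simp
  generalize lam * κ / (2 * M) = C at *
  linear_combination (-(k ^ 2 * (A * Real.exp (-(k * x)) + B * Real.exp (k * x)))) * hk2 + hC
end
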